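/- Let t ≥ 2, λ > 0, s(n) = n − ⌈λ n^{(t−1)/t}⌉, and Y_n the number of uniform s(n)-subset draws needed to collect all n coupons. Then lim_{n→∞} E[Y_n] = t·e^{−λ^t} + (t+1)·(1 − e^{−λ^t}). -/

import Mathlib

open Finset Filter
open scoped Classical

noncomputable section

/-- All tuples of `i` draws, each draw being an `s`-element subset of the `n` coupons.
The drawing process is uniform on this finite set. -/
def draws (n s i : ℕ) : Finset (Fin i → Finset (Fin n)) :=
  Finset.univ.filter (fun f => ∀ j, (f j).card = s)

/-- The probability, under `i` independent uniform `s`-subset draws from `n` coupons,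
of the event `p`. -/
def pr (n s i : ℕ) (p : (Fin i → Finset (Fin n)) → Prop) : ℝ :=
  (((draws n s i).filter p).card : ℝ) / ((draws n s i).card : ℝ)

/-- The event that every coupon has appeared in at least one of the draws. -/
def collected {n i : ℕ} (f : Fin i → Finset (Fin n)) : Prop :=
  ∀ t : Fin n, ∃ j, t ∈ f j

/-- The number of coupons missed by all the draws. -/
def missed {n i : ℕ} (f : Fin i → Finset (Fin n)) : ℕ :=
  (Finset.univ.filter (fun t : Fin n => ∀ j, t ∉ f j)).card

/-- `P(Y ≥ i)`: the probability that the collection is not complete after `i − 1` draws,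
where `Y` is the number of draws needed to collect all `n` coupons. -/
def PYge (n s i : ℕ) : ℝ := pr n s (i - 1) (fun f => ¬ collected f)

/-- `P(Y ≤ i)`: the probability that the collection is complete after `i` draws. -/
def PYle (n s i : ℕ) : ℝ := pr n s i (fun f => collected f)

/-- `P(Y = i)`. -/
def PYeq (n s i : ℕ) : ℝ := PYle n s i - if i = 0 then 0 else PYle n s (i - 1)

/-- `E[Y]`, via the tail-sum formula `E[Y] = ∑_{i≥1} P(Y ≥ i) = ∑_{i≥0} P(Y > i)`. -/
def EY (n s : ℕ) : ℝ := ∑' i : ℕ, pr n s i (fun f => ¬ collected f)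

end

def Nm {n i : ℕ} (f : Fin i → Finset (Fin n)) : Finset (Fin n) := univ.filter (fun t => ∀ j, t ∉ f j)

lemma draws_eq (n s i : ℕ) : draws n s i = Fintype.piFinset (fun _ => powersetCard s univ) := by
  ext f; simp [draws, mem_powersetCard]

lemma card_draws (n s i : ℕ) : (draws n s i).card = (n.choose s) ^ i := by
  rw [draws_eq]; simp

lemma card_missA (n s i : ℕ) (A : Finset (Fin n)) :
    ((draws n s i).filter (fun f => A ⊆ Nm f)).card = ((n - A.card).choose s) ^ i := by
  have : (draws n s i).filter (fun f => A ⊆ Nm f) = Fintype.piFinset (fun _ => powersetCard s Aᶜ) := by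
    ext f
    simp only [draws, Nm, mem_filter, mem_univ, true_and, Fintype.mem_piFinset, mem_powersetCard,
      subset_iff, mem_compl]
    constructor
    · rintro ⟨h1, h2⟩ j
      exact ⟨fun x hx hA => h2 hA j hx, h1 j⟩
    · intro h
      exact ⟨fun j => (h j).2, fun x hx j hj => (h j).1 hj hx⟩
  rw [this]; simp [card_compl]

lemma collected_iff {n i : ℕ} (f : Fin i → Finset (Fin n)) : collected f ↔ Nm f = ∅ := by
  simp [collected, Nm, filter_eq_empty_iff]

/-- ratio -/
noncomputable def rr (n s k : ℕ) : ℝ := ((n - k).choose s : ℝ) / (n.choose s : ℝ)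

lemma rr_nonneg (n s k : ℕ) : 0 ≤ rr n s k := by unfold rr; positivity

lemma card_collected (n s i : ℕ) :
    (((draws n s i).filter (fun f => collected f)).card : ℝ)
      = ∑ k ∈ range (n + 1), (n.choose k : ℝ) * ((-1) ^ k * ((n - k).choose s : ℝ) ^ i) := by
  have h1 : ∀ f : Fin i → Finset (Fin n), (if collected f then (1:ℝ) else 0)
      = ∑ A : Finset (Fin n), if A ⊆ Nm f then (-1 : ℝ) ^ A.card else 0 := by
    intro f
    rw [← sum_filter]
    have e : (univ.filter (fun A => A ⊆ Nm f)) = (Nm f).powerset := by ext; simp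
    rw [e]
    have := sum_powerset_neg_one_pow_card (x := Nm f)
    have h2 := congrArg (Int.cast : ℤ → ℝ) this
    push_cast at h2
    rw [h2]
    simp [collected_iff]
  rw [card_filter]
  push_cast
  rw [sum_congr rfl (fun f _ => h1 f), sum_comm]
  have h3 : ∀ A : Finset (Fin n), (∑ f ∈ draws n s i, if A ⊆ Nm f then (-1 : ℝ) ^ A.card else 0)
      = (-1) ^ A.card * ((n - A.card).choose s : ℝ) ^ i := by
    intro A
    rw [← sum_filter, sum_const, card_missA]
    simp [mul_comm]
  rw [sum_congr rfl (fun A _ => h3 A)]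
  have := sum_powerset_apply_card (fun k => (-1 : ℝ) ^ k * ((n - k).choose s : ℝ) ^ i) (x := (univ : Finset (Fin n)))
  simpa using this

lemma pr_collected (n s i : ℕ) :
    pr n s i (fun f => collected f)
      = ∑ k ∈ range (n + 1), (n.choose k : ℝ) * ((-1) ^ k * (rr n s k) ^ i) := by
  unfold pr
  rw [card_collected, card_draws, sum_div]
  refine sum_congr rfl fun k _ => ?_
  unfold rr
  rw [div_pow]; push_cast; ring

lemma pr_not (n s i : ℕ) (hs : s ≤ n) :
    pr n s i (fun f => ¬ collected f) = 1 - pr n s i (fun f => collected f) := by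
  have h : ((draws n s i).card : ℝ) ≠ 0 := by
    rw [card_draws]; have := Nat.choose_pos hs; positivity
  have := card_filter_add_card_filter_not (s := draws n s i) (fun f => collected f)
  unfold pr
  rw [eq_sub_iff_add_eq, ← add_div, div_eq_one_iff_eq h]
  rw [add_comm]; norm_cast; convert this

lemma rr_eq (n m k : ℕ) (hm : m ≤ n) (hk : k ≤ n) :
    rr n (n - m) k = (m.descFactorial k : ℝ) / n.descFactorial k := by
  unfold rr
  have h1 := Nat.choose_pos (Nat.sub_le n m)
  have h2 : 0 < n.descFactorial k := Nat.descFactorial_pos.2 hk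
  rw [div_eq_div_iff (by positivity) (by positivity)]
  rw [Nat.descFactorial_eq_factorial_mul_choose, Nat.descFactorial_eq_factorial_mul_choose]
  have key : (n - k).choose (n - m) * n.choose k = m.choose k * n.choose (n - m) := by
    rw [Nat.choose_symm hm]
    rcases le_or_gt k m with h | h
    · have := Nat.choose_mul (n := n) h
      rw [← Nat.choose_symm (show n - m ≤ n - k by omega)]
      have e : n - k - (n - m) = m - k := by omega
      rw [e]; linarith
    · rw [Nat.choose_eq_zero_of_lt h, Nat.choose_eq_zero_of_lt (show n - k < n - m by omega)]; simp
  have := congrArg (Nat.cast : ℕ → ℝ) key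
  push_cast at this ⊢
  linear_combination (k.factorial : ℝ) * this

lemma rr_le (n m k : ℕ) (hm : m ≤ n) (hk : k ≤ n) :
    rr n (n - m) k ≤ ((m : ℝ) / n) ^ k := by
  rw [rr_eq n m k hm hk]
  induction k with
  | zero => simp
  | succ k ih =>
    have := ih (by omega)
    rw [Nat.descFactorial_succ, Nat.descFactorial_succ, pow_succ]
    push_cast
    rw [mul_comm ((m - k : ℕ) : ℝ), mul_comm ((n - k : ℕ) : ℝ), mul_div_mul_comm]
    refine mul_le_mul this ?_ (by positivity) (by positivity)
    have h3 : 0 < n - k := by omega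
    have h4 : 0 < n := by omega
    rw [div_le_div_iff₀ (by positivity) (by positivity)]
    have : (m - k) * n ≤ m * (n - k) := by
      rcases le_or_gt k m with h | h
      · zify [h, (show k ≤ n by omega)]
        have : (k:ℤ) * m ≤ k * n := by gcongr
        linarith
      · rw [Nat.sub_eq_zero_of_le h.le]; simp
    exact_mod_cast this

lemma rr_one (n m : ℕ) (hm : m ≤ n) (hn : 1 ≤ n) : rr n (n - m) 1 = (m : ℝ) / n := by
  rw [rr_eq n m 1 hm hn]; simp

lemma sum_ratio (n s i : ℕ) (A : Finset (Fin n)) :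
    (∑ f ∈ draws n s i, if A ⊆ Nm f then (1:ℝ) else 0) / (draws n s i).card = rr n s A.card ^ i := by
  rw [← sum_filter, sum_const, card_missA, card_draws]
  unfold rr
  simp [div_pow]

/-- union bound -/
lemma pr_not_le (n m i : ℕ) (hm : m ≤ n) (hn : 1 ≤ n) :
    pr n (n - m) i (fun f => ¬ collected f) ≤ n * ((m : ℝ) / n) ^ i := by
  have h : ∀ f : Fin i → Finset (Fin n), (if ¬ collected f then (1:ℝ) else 0)
      ≤ ∑ a : Fin n, if {a} ⊆ Nm f then (1:ℝ) else 0 := by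
    intro f
    by_cases hc : collected f
    · rw [if_neg (not_not.2 hc)]
      exact sum_nonneg fun a _ => by split_ifs <;> norm_num
    · rw [if_pos hc]
      rw [collected_iff] at hc
      obtain ⟨a, ha⟩ := nonempty_iff_ne_empty.2 hc
      have := single_le_sum (f := fun a => if {a} ⊆ Nm f then (1:ℝ) else 0) (s := univ)
        (fun a _ => by split_ifs <;> norm_num) (mem_univ a)
      simpa [ha] using this
  unfold pr
  rw [card_filter]; push_cast
  calc _ ≤ (∑ f ∈ draws n (n-m) i, ∑ a : Fin n, if {a} ⊆ Nm f then (1:ℝ) else 0) / (draws n (n-m) i).card := by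
        gcongr with f; exact h f
    _ = ∑ a : Fin n, rr n (n-m) 1 ^ i := by
        rw [sum_comm, sum_div]
        refine sum_congr rfl fun a _ => ?_
        rw [sum_ratio]; simp
    _ = _ := by rw [rr_one n m hm hn]; simp

/-- second moment -/
lemma pr_coll_le (n m i : ℕ) (hm : m ≤ n) (hn : 2 ≤ n) :
    pr n (n - m) i (fun f => collected f) * (n * ((m : ℝ) / n) ^ i) ^ 2 ≤ n * ((m : ℝ) / n) ^ i := by
  set E : ℝ := n * ((m : ℝ) / n) ^ i with hE
  set D := draws n (n-m) i with hD
  have hX : ∀ f : Fin i → Finset (Fin n), ((Nm f).card : ℝ) = ∑ a : Fin n, if {a} ⊆ Nm f then (1:ℝ) else 0 := by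
    intro f; simp
  have hX2 : ∀ f : Fin i → Finset (Fin n), ((Nm f).card : ℝ)^2
      = ∑ a : Fin n, ∑ b : Fin n, if {a, b} ⊆ Nm f then (1:ℝ) else 0 := by
    intro f
    rw [sq, hX, sum_mul_sum]
    refine sum_congr rfl fun a _ => sum_congr rfl fun b _ => ?_
    simp only [insert_subset_iff, singleton_subset_iff]
    by_cases h1 : a ∈ Nm f <;> by_cases h2 : b ∈ Nm f <;> simp [h1, h2]
  have hD0 : (D.card : ℝ) ≠ 0 := by
    rw [hD, card_draws]; have := Nat.choose_pos (Nat.sub_le n m); positivity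
  have e1 : (∑ f ∈ D, ((Nm f).card : ℝ)) / D.card = E := by
    rw [sum_congr rfl fun f _ => hX f, sum_comm, sum_div]
    rw [sum_congr rfl fun a _ => sum_ratio n (n-m) i {a}]
    simp [rr_one n m hm (by omega), hE]
  have e2 : (∑ f ∈ D, ((Nm f).card : ℝ)^2) / D.card ≤ E + E ^ 2 := by
    rw [sum_congr rfl fun f _ => hX2 f, sum_comm, sum_div]
    have : ∀ a : Fin n, (∑ f ∈ D, ∑ b : Fin n, if {a, b} ⊆ Nm f then (1:ℝ) else 0) / D.card
        ≤ ((m : ℝ) / n) ^ i + n * (((m:ℝ)/n)^i)^2 := by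
      intro a
      rw [sum_comm, sum_div, sum_congr rfl fun b _ => sum_ratio n (n-m) i {a, b}]
      calc _ ≤ ∑ b : Fin n, ((if a = b then ((m : ℝ) / n) ^ i else 0) + (((m:ℝ)/n)^i)^2) := by
            refine sum_le_sum fun b _ => ?_
            by_cases hab : a = b
            · subst hab
              simp [rr_one n m hm (by omega)]; positivity
            · rw [card_pair hab]
              simp only [hab, if_false, zero_add]
              calc _ ≤ (((m:ℝ)/n)^2)^i := pow_le_pow_left₀ (rr_nonneg _ _ _) (rr_le n m 2 hm hn) i
                _ = _ := by rw [← pow_mul, ← pow_mul, mul_comm]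
        _ = _ := by rw [sum_add_distrib]; simp
    refine (sum_le_sum fun a _ => this a).trans (le_of_eq ?_)
    simp [hE]; ring
  have h : ∀ f : Fin i → Finset (Fin n), (if collected f then (1:ℝ) else 0) * E^2
      ≤ ((Nm f).card : ℝ)^2 - 2 * E * (Nm f).card + E^2 := by
    intro f
    split_ifs with hc
    · rw [collected_iff] at hc; simp [hc]
    · nlinarith [sq_nonneg (((Nm f).card : ℝ) - E)]
  have h5 : pr n (n - m) i (fun f => collected f) * E^2 ≤
      (∑ f ∈ D, (((Nm f).card : ℝ)^2 - 2 * E * (Nm f).card + E^2)) / D.card := by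
    unfold pr
    rw [card_filter]; push_cast
    rw [div_mul_eq_mul_div, sum_mul]
    gcongr with f; exact h f
  rw [sum_add_distrib, sum_sub_distrib, ← mul_sum, add_div, sub_div, mul_div_assoc, e1] at h5
  simp only [sum_const, nsmul_eq_mul, mul_div_cancel_left₀ _ hD0] at h5
  nlinarith

lemma desc_ratio (k : ℕ) : Tendsto (fun n : ℕ => (n.descFactorial k : ℝ) / (n:ℝ) ^ k) atTop (nhds 1) := by
  have h := isEquivalent_descFactorial k
  rw [Asymptotics.isEquivalent_iff_tendsto_one] at h
  · exact h
  · filter_upwards [eventually_gt_atTop 0] with n hn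
    positivity

/-- the Poisson limit, by inclusion-exclusion and Tannery's theorem -/
lemma lim_t (t : ℕ) (L : ℝ) (m : ℕ → ℕ) (hm : Tendsto m atTop atTop)
    (hmn : ∀ᶠ n in atTop, m n ≤ n)
    (hL : Tendsto (fun n : ℕ => (n : ℝ) * ((m n : ℝ) / n) ^ t) atTop (nhds L)) :
    Tendsto (fun n => pr n (n - m n) t (fun f => collected f)) atTop (nhds (Real.exp (-L))) := by
  have e1 : ∀ n, pr n (n - m n) t (fun f => collected f)
      = ∑' k, (n.choose k : ℝ) * ((-1) ^ k * (rr n (n - m n) k) ^ t) := by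
    intro n
    rw [pr_collected, tsum_eq_sum]
    intro k hk
    rw [Nat.choose_eq_zero_of_lt (by rw [Finset.mem_range] at hk; omega)]; simp
  have e2 : Real.exp (-L) = ∑' k : ℕ, (-L) ^ k / (k.factorial : ℝ) := by
    rw [Real.exp_eq_exp_ℝ, NormedSpace.exp_eq_tsum_div]
  simp_rw [e1]
  rw [e2]
  refine tendsto_tsum_of_dominated_convergence (bound := fun k : ℕ => (L + 1) ^ k / (k.factorial : ℝ))
    (Real.summable_pow_div_factorial _) ?_ ?_
  · intro k
    have a1 := (desc_ratio k).div_const (k.factorial : ℝ)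
    have a2 : Tendsto (fun n : ℕ => (((m n).descFactorial k : ℝ) / (m n : ℝ) ^ k / ((n.descFactorial k : ℝ) / (n:ℝ) ^ k)) ^ t) atTop (nhds ((1 / 1) ^ t)) := (((desc_ratio k).comp hm).div (desc_ratio k) one_ne_zero).pow t
    have a3 := ((a1.mul a2).mul (hL.pow k)).mul_const ((-1 : ℝ) ^ k)
    have e : 1 / (k.factorial : ℝ) * (1 / 1) ^ t * L ^ k * (-1) ^ k = (-L) ^ k / (k.factorial : ℝ) := by
      rw [neg_pow L]; simp; ring
    rw [e] at a3
    refine a3.congr' ?_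
    filter_upwards [hmn, eventually_ge_atTop k, eventually_gt_atTop 0, hm.eventually_gt_atTop 0] with n h1 h2 h3 h4
    rw [rr_eq n _ k h1 h2]
    have d : (0:ℝ) < n.descFactorial k := by exact_mod_cast Nat.descFactorial_pos.2 h2
    have h3' : (0:ℝ) < n := by exact_mod_cast h3
    have h4' : (0:ℝ) < m n := by exact_mod_cast h4
    have c : (n.choose k : ℝ) = n.descFactorial k / k.factorial := by
      rw [Nat.descFactorial_eq_factorial_mul_choose]; push_cast
      field_simp
    rw [c]
    have : (((m n).descFactorial k : ℝ) / (m n : ℝ) ^ k / ((n.descFactorial k : ℝ) / (n:ℝ) ^ k))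
       = ((m n).descFactorial k : ℝ) / (n.descFactorial k : ℝ) / ((m n : ℝ) / n) ^ k := by
      rw [div_pow]; field_simp
    rw [this, mul_pow, ← pow_mul, mul_comm t k, pow_mul, div_pow _ _ t]
    have p1 : (((m n : ℝ) / n) ^ k) ^ t ≠ 0 := by positivity
    field_simp
  · filter_upwards [hmn, hL.eventually_le_const (lt_add_one L)] with n h1 h2 k
    rw [norm_mul, norm_mul, norm_pow, norm_neg, norm_one, one_pow, one_mul, Real.norm_of_nonneg (by positivity),
      Real.norm_of_nonneg (pow_nonneg (rr_nonneg _ _ _) _)]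
    rcases le_or_gt k n with hk | hk
    · calc _ ≤ ((n:ℝ) ^ k / k.factorial) * (((m n : ℝ) / n) ^ k) ^ t := by
            gcongr
            · exact pow_nonneg (rr_nonneg _ _ _) _
            · exact Nat.choose_le_pow_div k n
            · exact rr_nonneg _ _ _
            · exact rr_le n _ k h1 hk
        _ = ((n : ℝ) * ((m n : ℝ) / n) ^ t) ^ k / k.factorial := by
            rw [mul_pow, ← pow_mul, ← pow_mul, mul_comm t k]; ring
        _ ≤ _ := by gcongr
    · rw [Nat.choose_eq_zero_of_lt hk]
      have : 0 ≤ L + 1 := le_trans (by positivity) h2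
      simp; positivity

lemma pr_nonneg (n s i : ℕ) (p : (Fin i → Finset (Fin n)) → Prop) : 0 ≤ pr n s i p := by
  unfold pr; positivity

lemma lim_lt (t i : ℕ) (hi : i < t) (L : ℝ) (hL0 : 0 < L) (m : ℕ → ℕ) (hm : Tendsto m atTop atTop)
    (hmn : ∀ᶠ n in atTop, m n ≤ n)
    (h0 : Tendsto (fun n : ℕ => (m n : ℝ) / n) atTop (nhds 0))
    (hL : Tendsto (fun n : ℕ => (n : ℝ) * ((m n : ℝ) / n) ^ t) atTop (nhds L)) :
    Tendsto (fun n => pr n (n - m n) i (fun f => collected f)) atTop (nhds 0) := by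
  have a : Tendsto (fun n : ℕ => ((m n : ℝ) / n) ^ (t - i) / ((n : ℝ) * ((m n : ℝ) / n) ^ t)) atTop (nhds 0) := by
    have : Tendsto (fun n : ℕ => ((m n : ℝ) / n) ^ (t - i) / ((n : ℝ) * ((m n : ℝ) / n) ^ t)) atTop (nhds (0 ^ (t - i) / L)) := (h0.pow (t - i)).div hL hL0.ne'
    simpa [show t - i ≠ 0 by omega] using this
  refine squeeze_zero' (Eventually.of_forall fun n => pr_nonneg _ _ _ _) ?_ a
  filter_upwards [hmn, eventually_ge_atTop 2, hm.eventually_gt_atTop 0] with n h1 h2 h3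
  have h := pr_coll_le n (m n) i h1 h2
  have h3' : (0:ℝ) < m n := by exact_mod_cast h3
  have h2' : (0:ℝ) < n := by exact_mod_cast (show 0 < n by omega)
  have hx : 0 < (m n : ℝ) / n := by positivity
  set x := (m n : ℝ) / n
  have e : x ^ t = x ^ i * x ^ (t - i) := by rw [← pow_add]; congr 1; omega
  rw [e]
  have : x ^ (t - i) / ((n:ℝ) * (x ^ i * x ^ (t - i))) = 1 / (n * x ^ i) := by field_simp
  rw [this, le_div_iff₀ (by positivity)]
  have pE : 0 < (n:ℝ) * x ^ i := by positivity
  refine le_of_mul_le_mul_right ?_ pE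
  linarith [h]

lemma main_lim (t : ℕ) (L : ℝ) (hL0 : 0 < L) (m : ℕ → ℕ) (hm : Tendsto m atTop atTop)
    (h0 : Tendsto (fun n : ℕ => (m n : ℝ) / n) atTop (nhds 0))
    (hL : Tendsto (fun n : ℕ => (n : ℝ) * ((m n : ℝ) / n) ^ t) atTop (nhds L)) :
    Tendsto (fun n => EY n (n - m n)) atTop (nhds (t + (1 - Real.exp (-L)))) := by
  have hhalf : ∀ᶠ n : ℕ in atTop, (m n : ℝ) / n ≤ 1 / 2 := h0.eventually_le_const (by norm_num)
  have hmn : ∀ᶠ n in atTop, m n ≤ n := by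
    filter_upwards [hhalf, eventually_gt_atTop 0] with n h1 h2
    have h2' : (0:ℝ) < n := by exact_mod_cast h2
    rw [div_le_iff₀ h2'] at h1
    have : (m n : ℝ) ≤ n := by linarith
    exact_mod_cast this
  set q : ℕ → ℕ → ℝ := fun n i => pr n (n - m n) i (fun f => ¬ collected f) with hq
  have q1 : ∀ i < t, Tendsto (fun n => q n i) atTop (nhds 1) := by
    intro i hi
    have := (lim_lt t i hi L hL0 m hm hmn h0 hL).const_sub 1
    rw [sub_zero] at this
    exact this.congr fun n => (pr_not n _ i (Nat.sub_le _ _)).symm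
  have q2 : Tendsto (fun n => q n t) atTop (nhds (1 - Real.exp (-L))) := by
    have := (lim_t t L m hm hmn hL).const_sub 1
    exact this.congr fun n => (pr_not n _ t (Nat.sub_le _ _)).symm
  have q3 : Tendsto (fun n => ∑ i ∈ range (t + 1), q n i) atTop (nhds (t + (1 - Real.exp (-L)))) := by
    simp_rw [sum_range_succ]
    refine Tendsto.add ?_ q2
    have := tendsto_finsetSum (range t) (fun i hi => q1 i (mem_range.1 hi))
    simpa using this
  have good : ∀ᶠ n : ℕ in atTop, Summable (q n) ∧
      ∑' j, q n (j + (t + 1)) ≤ 2 * (((n : ℝ) * ((m n : ℝ) / n) ^ t) * ((m n : ℝ) / n)) := by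
    filter_upwards [hhalf, hmn, eventually_ge_atTop 1] with n h1 h2 h3
    have hx0 : 0 ≤ (m n : ℝ) / n := by positivity
    have b : ∀ i, q n i ≤ n * ((m n : ℝ) / n) ^ i := fun i => pr_not_le n (m n) i h2 h3
    set x := (m n : ℝ) / n
    have hx1 : x < 1 := by linarith
    have sg := summable_geometric_of_lt_one hx0 hx1
    have hs : Summable (q n) := Summable.of_nonneg_of_le (fun i => pr_nonneg _ _ _ _) b (sg.mul_left _)
    refine ⟨hs, ?_⟩
    have b' : ∀ j, q n (j + (t + 1)) ≤ ((n:ℝ) * x ^ t * x) * x ^ j := fun j =>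
      (b _).trans (le_of_eq (by ring))
    have := Summable.tsum_le_tsum b' ((summable_nat_add_iff (t+1)).2 hs) (sg.mul_left _)
    refine this.trans ?_
    rw [tsum_mul_left, tsum_geometric_of_lt_one hx0 hx1, mul_comm (2:ℝ)]
    refine mul_le_mul_of_nonneg_left ?_ (by positivity)
    rw [inv_le_comm₀ (by linarith) (by norm_num)]; linarith
  have q4 : Tendsto (fun n => ∑' j, q n (j + (t + 1))) atTop (nhds 0) := by
    refine squeeze_zero' (Eventually.of_forall fun n => tsum_nonneg fun j => pr_nonneg _ _ _ _)
      (good.mono fun n h => h.2) ?_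
    simpa using (hL.mul h0).const_mul 2
  have := q3.add q4
  rw [add_zero] at this
  refine this.congr' ?_
  filter_upwards [good] with n h
  exact h.1.sum_add_tsum_nat_add (t + 1)

/-- Case III: with `s(n) = n − ⌈λ n^{(t−1)/t}⌉`,
`E[Y_n] → t·e^{−λ^t} + (t+1)·(1 − e^{−λ^t})`. -/
theorem stmt15 (t : ℕ) (ht : 2 ≤ t) (lam : ℝ) (hlam : 0 < lam) :
    Tendsto
      (fun n : ℕ => EY n (n - ⌈lam * (n : ℝ) ^ (((t : ℝ) - 1) / (t : ℝ))⌉₊))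
      atTop
      (nhds ((t : ℝ) * Real.exp (-(lam ^ t))
        + ((t : ℝ) + 1) * (1 - Real.exp (-(lam ^ t))))) := by
  have ht0 : (0:ℝ) < t := by exact_mod_cast (show 0 < t by omega)
  have ht1 : (1:ℝ) < t := by exact_mod_cast (show 1 < t by omega)
  set α : ℝ := ((t:ℝ) - 1) / t with hα
  have hα0 : 0 < α := div_pos (by linarith) ht0
  have hx : Tendsto (fun n : ℕ => (n:ℝ) ^ α) atTop atTop :=
    (tendsto_rpow_atTop hα0).comp tendsto_natCast_atTop_atTop
  set m : ℕ → ℕ := fun n => ⌈lam * (n : ℝ) ^ α⌉₊ with hmdef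
  have hm : Tendsto m atTop atTop := tendsto_nat_ceil_atTop.comp (hx.const_mul_atTop hlam)
  have hr : Tendsto (fun n : ℕ => (m n : ℝ) / (n:ℝ) ^ α) atTop (nhds lam) :=
    (tendsto_nat_ceil_mul_div_atTop hlam.le).comp hx
  have h0 : Tendsto (fun n : ℕ => (m n : ℝ) / n) atTop (nhds 0) := by
    have a : Tendsto (fun n : ℕ => (n:ℝ) ^ (-(1 / (t:ℝ)))) atTop (nhds 0) :=
      (tendsto_rpow_neg_atTop (by positivity)).comp tendsto_natCast_atTop_atTop
    have b := hr.mul a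
    rw [mul_zero] at b
    refine b.congr' ?_
    filter_upwards [eventually_gt_atTop 0] with n hn
    have hn' : (0:ℝ) < n := by exact_mod_cast hn
    have e : (n:ℝ) = (n:ℝ) ^ α * (n:ℝ) ^ (1 / (t:ℝ)) := by
      rw [← Real.rpow_add hn', hα, ← add_div, sub_add_cancel, div_self ht0.ne', Real.rpow_one]
    rw [Real.rpow_neg hn'.le]
    conv_rhs => rw [e]
    field_simp
  have hL : Tendsto (fun n : ℕ => (n : ℝ) * ((m n : ℝ) / n) ^ t) atTop (nhds (lam ^ t)) := by
    refine (hr.pow t).congr' ?_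
    filter_upwards [eventually_gt_atTop 0] with n hn
    have hn' : (0:ℝ) < n := by exact_mod_cast hn
    have e : (n:ℝ) * ((n:ℝ) ^ α) ^ t = (n:ℝ) ^ t := by
      rw [← Real.rpow_natCast ((n:ℝ) ^ α), ← Real.rpow_mul hn'.le, hα, div_mul_cancel₀ _ ht0.ne',
        Real.rpow_sub hn', Real.rpow_one, Real.rpow_natCast]
      field_simp
    rw [div_pow, div_pow, ← e]
    field_simp
  have := main_lim t (lam ^ t) (by positivity) m hm h0 hL
  convert this using 2
  ring
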